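/- arXiv:0807.2929 — 3 statements merged into one kernel-verified Lean document; each statement's English description precedes it below -/
import Mathlib

section
/- The classical eight-step symmetric method of Quinlan and Tremaine has algebraic order eight; concretely, it integrates all polynomials of degree at most 9 exactly: for every real polynomial p with deg p ≤ 9 and all real x and h, p(x+4h) + p(x-4h) - 2(p(x+3h) + p(x-3h)) + 2(p(x+2h) + p(x-2h)) - (p(x+h) + p(x-h)) = h^2 · [ (17671/12096)(p''(x+3h) + p''(x-3h)) - (23622/12096)(p''(x+2h) + p''(x-2h)) + (61449/12096)(p''(x+h) + p''(x-h)) - (50516/12096)·p''(x) ]. -/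
/-- The classical Quinlan–Tremaine eight-step symmetric method integrates exactly
all real polynomials of degree at most 9 (algebraic order eight). -/
theorem quinlan_tremaine_algebraic_order_eight
    (p : Polynomial ℝ) (hp : p.degree ≤ 9) (x h : ℝ) :
    p.eval (x + 4 * h) + p.eval (x - 4 * h)
      - 2 * (p.eval (x + 3 * h) + p.eval (x - 3 * h))
      + 2 * (p.eval (x + 2 * h) + p.eval (x - 2 * h))
      - (p.eval (x + h) + p.eval (x - h))
    = h ^ 2 *
      ((17671 / 12096) *
          ((Polynomial.derivative (Polynomial.derivative p)).eval (x + 3 * h)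
            + (Polynomial.derivative (Polynomial.derivative p)).eval (x - 3 * h))
        - (23622 / 12096) *
          ((Polynomial.derivative (Polynomial.derivative p)).eval (x + 2 * h)
            + (Polynomial.derivative (Polynomial.derivative p)).eval (x - 2 * h))
        + (61449 / 12096) *
          ((Polynomial.derivative (Polynomial.derivative p)).eval (x + h)
            + (Polynomial.derivative (Polynomial.derivative p)).eval (x - h))
        - (50516 / 12096) *
          (Polynomial.derivative (Polynomial.derivative p)).eval x) := by
  have hlt : p.natDegree < 10 :=
    Nat.lt_succ_of_le (Polynomial.natDegree_le_of_degree_le hp)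
  rw [p.as_sum_range_C_mul_X_pow' hlt]
  simp only [Finset.sum_range_succ, Finset.sum_range_zero, Polynomial.derivative_add,
    Polynomial.derivative_C_mul_X_pow, Polynomial.derivative_zero, Polynomial.eval_add,
    Polynomial.eval_zero, Polynomial.eval_C_mul, Polynomial.eval_X_pow]
  push_cast
  ring
end

section
/- The coefficients of the phase-fitted 8-step method tend to the classical Quinlan–Tremaine coefficients as v → 0: with b3(v) = (1/96)·C(v)/D(v), C(v) = -192·cos(v)^4 + 192·cos(v)^3 + (96 - 327·v^2)·cos(v)^2 + (-120 + 404·v^2)·cos(v) - 137·v^2 + 24, D(v) = v^2·(cos(v) - 1)^3, b2(v) = -6·b3(v) + 109/16, b1(v) = 15·b3(v) - 101/6, b0(v) = -20·b3(v) + 601/24, one has, as v → 0 with v ≠ 0: b0(v) → -12629/3024, b1(v) → 20483/4032, b2(v) → -3937/2016, and b3(v) → 17671/12096. -/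
/-- Numerator of the phase-fitted `b3` coefficient. -/
noncomputable def C (v : ℝ) : ℝ :=
  -192 * Real.cos v ^ 4 + 192 * Real.cos v ^ 3
    + (96 - 327 * v ^ 2) * Real.cos v ^ 2
    + (-120 + 404 * v ^ 2) * Real.cos v - 137 * v ^ 2 + 24

/-- Denominator of the phase-fitted `b3` coefficient. -/
noncomputable def D (v : ℝ) : ℝ := v ^ 2 * (Real.cos v - 1) ^ 3

/-- Variable coefficients of the phase-fitted 8-step method. -/
noncomputable def b3PF (v : ℝ) : ℝ := (1 / 96) * C v / D v

noncomputable def b2PF (v : ℝ) : ℝ := -6 * b3PF v + 109 / 16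

noncomputable def b1PF (v : ℝ) : ℝ := 15 * b3PF v - 101 / 6

noncomputable def b0PF (v : ℝ) : ℝ := -20 * b3PF v + 601 / 24

open Filter Topology

/-- The remainder of the degree-six Taylor polynomial of cosine at `0`, divided by `v ^ 8`. -/
noncomputable def cosRemainder (v : ℝ) : ℝ :=
  (Real.cos v - (1 - v ^ 2 / 2 + v ^ 4 / 24 - v ^ 6 / 720)) / v ^ 8

theorem cos_eq_add_cosRemainder {v : ℝ} (hv : v ≠ 0) :
    Real.cos v = 1 - v ^ 2 / 2 + v ^ 4 / 24 - v ^ 6 / 720 + v ^ 8 * cosRemainder v := by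
  rw [cosRemainder, mul_div_cancel₀ _ (pow_ne_zero 8 hv)]
  ring

theorem tendsto_cosRemainder :
    Tendsto cosRemainder (𝓝[≠] 0) (𝓝 (1 / 40320)) := by
  have h := (taylor_isLittleO_univ (x₀ := 0) (n := 8)
    Real.contDiff_cos).tendsto_div_nhds_zero.mono_left (nhdsWithin_le_nhds (s := {0}ᶜ))
  have h' := h.add_const (1 / 40320 : ℝ)
  rw [zero_add] at h'
  refine h'.congr' ?_
  filter_upwards [self_mem_nhdsWithin] with v hv
  have hv : v ≠ 0 := hv
  simp [taylorWithinEval_succ, iteratedDerivWithin_univ, iteratedDeriv_succ, cosRemainder,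
    Nat.factorial]
  field_simp
  ring

/-- The quotient of `C v` by `v ^ 8`, as a polynomial in `v` and `r = cosRemainder v`. -/
noncomputable def reducedC (v r : ℝ) : ℝ :=
  (-631 / 36 + 2957 / 576 * v ^ 2 - 6377 / 8640 * v ^ 4 + 11459 / 172800 * v ^ 6
          - 7 / 1728 * v ^ 8 + 37 / 216000 * v ^ 10 - 19 / 3888000 * v ^ 12
          + 1 / 11664000 * v ^ 14 - 1 / 1399680000 * v ^ 16)
        + (-120 + 230 * v ^ 2 - 145 * v ^ 4 + 1705 / 12 * v ^ 6 - 3419 / 120 * v ^ 8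
          + 3 * v ^ 10 - 173 / 900 * v ^ 12 + 7 / 900 * v ^ 14 - 1 / 5400 * v ^ 16
          + 1 / 486000 * v ^ 18) * r
        + (-480 * v ^ 8 + 537 * v ^ 10 - 360 * v ^ 12 + 252 / 5 * v ^ 14 - 18 / 5 * v ^ 16
          + 2 / 15 * v ^ 18 - 1 / 450 * v ^ 20) * r ^ 2
        + (-576 * v ^ 16 + 384 * v ^ 18 - 32 * v ^ 20 + 16 / 15 * v ^ 22) * r ^ 3
        + (-192 * v ^ 24) * r ^ 4

/-- The quotient of `D v` by `v ^ 8`, as a polynomial in `v` and `r = cosRemainder v`. -/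
noncomputable def reducedD (v r : ℝ) : ℝ :=
  (-1 / 2 + v ^ 2 / 24 - v ^ 4 / 720 + v ^ 6 * r) ^ 3

theorem C_eq_mul_reducedC {v : ℝ} (hv : v ≠ 0) :
    C v = v ^ 8 * reducedC v (cosRemainder v) := by
  rw [C, cos_eq_add_cosRemainder hv, reducedC]
  ring

theorem D_eq_mul_reducedD {v : ℝ} (hv : v ≠ 0) :
    D v = v ^ 8 * reducedD v (cosRemainder v) := by
  rw [D, cos_eq_add_cosRemainder hv, reducedD]
  ring

theorem tendsto_b3PF : Tendsto b3PF (𝓝[≠] 0) (𝓝 (17671 / 12096)) := by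
  have hpair : Tendsto (fun v => (v, cosRemainder v)) (𝓝[≠] 0) (𝓝 (0, 1 / 40320)) :=
    (tendsto_id.mono_left nhdsWithin_le_nhds).prodMk_nhds tendsto_cosRemainder
  have hcont : ContinuousAt (fun p : ℝ × ℝ => 1 / 96 * reducedC p.1 p.2 / reducedD p.1 p.2)
      (0, 1 / 40320) := by
    refine ContinuousAt.div ?_ ?_ (by norm_num [reducedD])
    · unfold reducedC
      fun_prop
    · unfold reducedD
      fun_prop
  have hlim := hcont.tendsto.comp hpair
  have hval : 1 / 96 * reducedC 0 (1 / 40320) / reducedD 0 (1 / 40320) = 17671 / 12096 := by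
    norm_num [reducedC, reducedD]
  simp only [hval] at hlim
  refine hlim.congr' ?_
  filter_upwards [self_mem_nhdsWithin] with v hv
  rw [b3PF, C_eq_mul_reducedC hv, D_eq_mul_reducedD hv, mul_left_comm,
    mul_div_mul_left _ _ (pow_ne_zero 8 hv)]
  rfl

/-- The coefficients of the phase-fitted 8-step method tend to the classical
Quinlan–Tremaine coefficients as `v → 0`, `v ≠ 0`. -/
theorem phase_fitted_coeffs_tendsto_classical :
    Filter.Tendsto b0PF (nhdsWithin 0 {(0 : ℝ)}ᶜ) (nhds (-12629 / 3024)) ∧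
    Filter.Tendsto b1PF (nhdsWithin 0 {(0 : ℝ)}ᶜ) (nhds (20483 / 4032)) ∧
    Filter.Tendsto b2PF (nhdsWithin 0 {(0 : ℝ)}ᶜ) (nhds (-3937 / 2016)) ∧
    Filter.Tendsto b3PF (nhdsWithin 0 {(0 : ℝ)}ᶜ) (nhds (17671 / 12096)) := by
  have h := tendsto_b3PF
  refine ⟨?_, ?_, ?_, h⟩
  · convert! (h.const_mul (-20)).add_const (601 / 24) using 2
    norm_num
  · convert! (h.const_mul 15).sub_const (101 / 6) using 2
    norm_num
  · convert! (h.const_mul (-6)).add_const (109 / 16) using 2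
    norm_num
end

section
/- Let y : ℝ → ℝ be infinitely differentiable and let x ∈ ℝ. For the classical Quinlan–Tremaine method, define L_h = y(x+4h) + y(x-4h) - 2(y(x+3h)+y(x-3h)) + 2(y(x+2h)+y(x-2h)) - (y(x+h)+y(x-h)) - h^2·[ (17671/12096)(y''(x+3h)+y''(x-3h)) - (23622/12096)(y''(x+2h)+y''(x-2h)) + (61449/12096)(y''(x+h)+y''(x-h)) - (50516/12096)·y''(x) ]. Then L_h / h^10 → (45767/725760)·y^{(10)}(x) as h → 0 with h ≠ 0; i.e., the principal term of the local truncation error of the classical method is (45767/725760)·h^10·y^{(10)}. -/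
open Filter Topology Asymptotics in
/-- Taylor's theorem with Peano remainder along the line `h ↦ x + c * h`. -/
theorem taylor_add_mul_isLittleO {f : ℝ → ℝ} {n : ℕ} (hf : ContDiff ℝ n f) (x c : ℝ) :
    (fun h : ℝ => f (x + c * h) - ∑ k ∈ Finset.range (n + 1),
      ((k.factorial : ℝ)⁻¹ * (c * h) ^ k) * iteratedDeriv k f x) =o[𝓝 0] fun h => h ^ n := by
  have ht : Tendsto (fun h : ℝ => x + c * h) (𝓝 0) (𝓝 x) := by
    have : Continuous fun h : ℝ => x + c * h := by fun_prop
    simpa using this.tendsto 0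
  have key := (taylor_isLittleO_univ (x₀ := x) hf).comp_tendsto ht
  simp only [Function.comp_def, taylor_within_apply, iteratedDerivWithin_univ, smul_eq_mul,
    add_sub_cancel_left, mul_pow c] at key
  simp only [mul_pow]
  exact key.trans_isBigO (isBigO_const_mul_self _ _ _)

theorem iteratedDeriv_iteratedDeriv_add (f : ℝ → ℝ) (m n : ℕ) :
    iteratedDeriv m (iteratedDeriv n f) = iteratedDeriv (m + n) f := by
  simp only [iteratedDeriv_eq_iterate, Function.iterate_add_apply]

/-- The principal term of the local truncation error of the classical
Quinlan–Tremaine method is `(45767/725760) · h^10 · y⁽¹⁰⁾`. -/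
theorem classical_method_principal_LTE
    (y : ℝ → ℝ) (hy : ContDiff ℝ (⊤ : ℕ∞) y) (x : ℝ) :
    Filter.Tendsto
      (fun h : ℝ =>
        (y (x + 4 * h) + y (x - 4 * h)
          - 2 * (y (x + 3 * h) + y (x - 3 * h))
          + 2 * (y (x + 2 * h) + y (x - 2 * h))
          - (y (x + h) + y (x - h))
          - h ^ 2 *
            ((17671 / 12096) * (iteratedDeriv 2 y (x + 3 * h) + iteratedDeriv 2 y (x - 3 * h))
              - (23622 / 12096) * (iteratedDeriv 2 y (x + 2 * h) + iteratedDeriv 2 y (x - 2 * h))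
              + (61449 / 12096) * (iteratedDeriv 2 y (x + h) + iteratedDeriv 2 y (x - h))
              - (50516 / 12096) * iteratedDeriv 2 y x)) / h ^ 10)
      (nhdsWithin 0 {(0 : ℝ)}ᶜ)
      (nhds ((45767 / 725760) * iteratedDeriv 10 y x)) := by
  have hy10 : ContDiff ℝ (10 : ℕ) y := contDiff_infty.1 hy 10
  have hy2 : ContDiff ℝ (8 : ℕ) (iteratedDeriv 2 y) := by
    rw [iteratedDeriv_eq_iterate]
    exact hy10.iterate_deriv' 8 2
  have hY := taylor_add_mul_isLittleO hy10 x
  have hF (c : ℝ) := (Asymptotics.isBigO_refl (fun h : ℝ => h ^ 2) (nhds 0)).mul_isLittleO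
    (taylor_add_mul_isLittleO hy2 x c)
  simp only [← pow_add, Nat.reduceAdd, iteratedDeriv_iteratedDeriv_add] at hF
  have hYs (c : ℝ) := (hY c).add (hY (-c))
  have hFs (c : ℝ) := (hF c).add (hF (-c))
  have total := ((((hYs 4).sub ((hYs 3).const_mul_left 2)).add ((hYs 2).const_mul_left 2)).sub
    (hYs 1)).sub ((((hFs 3).const_mul_left (17671 / 12096)).sub
      ((hFs 2).const_mul_left (23622 / 12096))).add ((hFs 1).const_mul_left (61449 / 12096)))
  have lim := (total.tendsto_div_nhds_zero.mono_left
    (nhdsWithin_le_nhds (s := {(0 : ℝ)}ᶜ))).add_const (45767 / 725760 * iteratedDeriv 10 y x)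
  rw [zero_add] at lim
  refine lim.congr' ?_
  filter_upwards [self_mem_nhdsWithin] with h hh
  have hh0 : h ≠ 0 := hh
  rw [div_add' _ _ _ (pow_ne_zero 10 hh0)]
  congr 1
  simp only [Finset.sum_range_succ, Finset.sum_range_zero, Nat.factorial, neg_mul, one_mul,
    ← sub_eq_add_neg, iteratedDeriv_zero]
  push_cast
  ring
end
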